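/- arXiv:1104.0388 — 2 statements merged into one kernel-verified Lean document; each statement's English description precedes it below -/
import Mathlib

section
/- Let k ≥ 4 and let w be a word over Σ = {a,b}. Let p be an occurrence of u and q an occurrence of v in w such that p and q are consecutive with p before q, and let F_p, F_q be their sets of forbidden positions with |F_p| = |F_q|. Suppose F_q = {0} ∪ {i, i+1, …, k−2} for some i with 1 < i ≤ k−2, and suppose F_p forms a single block of cyclically consecutive residues modulo k (i.e. F_p = {f, f+1, …, f+m−1} taken modulo k for some f and m). Then either F_p = {0, 1} ∪ {i+2, i+3, …, k−1} or F_p = {0} ∪ {i+1, i+2, …, k−1}. -/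
namespace Restivo

/-- Words over the two-letter alphabet Σ = {a, b}, encoded as lists of booleans. -/
abbrev Word := List Bool

/-- The letter `a`. -/
def a : Bool := false

/-- The letter `b`. -/
def b : Bool := true

/-- Kleene star: all finite concatenations of words from `S` (including the empty word). -/
def kstar (S : Set Word) : Set Word :=
  { w | ∃ L : List Word, (∀ x ∈ L, x ∈ S) ∧ L.flatten = w }

/-- Prefixes of words of `L`. -/
def Pref (L : Set Word) : Set Word := { w | ∃ z : Word, w ++ z ∈ L }

/-- Factors (contiguous subwords) of words of `L`. -/
def Facts (L : Set Word) : Set Word := { w | ∃ x y : Word, x ++ w ++ y ∈ L }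

/-- The word u = b a^(k-1). -/
def u (k : ℕ) : Word := b :: List.replicate (k - 1) a

/-- The word v = b^(k-1) a. -/
def v (k : ℕ) : Word := List.replicate (k - 1) b ++ [a]

/-- The set S_k = (Σ^k \ {u, v}) ∪ (Σ^(k-1) \ {a^(k-1), b^(k-1)}). -/
def Sk (k : ℕ) : Set Word :=
  { w | w.length = k ∧ w ≠ u k ∧ w ≠ v k } ∪
  { w | w.length = k - 1 ∧ w ≠ List.replicate (k - 1) a ∧ w ≠ List.replicate (k - 1) b }

/-- Position `j` is forbidden in `w` w.r.t. `S` if the suffix of `w` starting from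
position `j` is not a prefix of any word of `S*`. -/
def Forbidden (S : Set Word) (w : Word) (j : ℕ) : Prop :=
  w.drop j ∉ Pref (kstar S)

/-- The word `p` occurs in `w` at position `s`. -/
def OccursAt (p w : Word) (s : ℕ) : Prop :=
  s + p.length ≤ w.length ∧ (w.drop s).take p.length = p

/-- The set of (locally enumerated) forbidden positions of the occurrence of `p`
at position `s` in `w`, with respect to `S_k`. -/
def Focc (k : ℕ) (w p : Word) (s : ℕ) : Set ℕ :=
  { i | i < p.length ∧ Forbidden (Sk k) w (s + i) }

/-- Two occurrences (of words from {u, v}) at positions `s < t` in `w` are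
consecutive: no word from {u, v} occurs at a position strictly between them. -/
def Consecutive (k : ℕ) (w : Word) (s t : ℕ) : Prop :=
  s < t ∧ ∀ m, s < m → m < t → ¬ OccursAt (u k) w m ∧ ¬ OccursAt (v k) w m

/-- `w` is a minimal uncompletable word for `S`. -/
def MinUncompletable (S : Set Word) (w : Word) : Prop :=
  w ∉ Facts (kstar S) ∧ ∀ w' : Word, w' ∉ Facts (kstar S) → w.length ≤ w'.length

lemma mem_pref_of_take {S : Set Word} {x : Word} {n : ℕ} (h : x.take n ∈ S)
    (hd : x.drop n ∈ Pref (kstar S)) : x ∈ Pref (kstar S) := by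
  obtain ⟨z, L, hL, hz⟩ := hd
  refine ⟨z, x.take n :: L, ?_, ?_⟩
  · simpa using ⟨h, hL⟩
  · rw [List.flatten_cons, hz, ← List.append_assoc, List.take_append_drop]

lemma length_of_mem_Sk {k : ℕ} {x : Word} (h : x ∈ Sk k) : x.length = k ∨ x.length = k - 1 :=
  h.imp And.left And.left

lemma exists_take_mem_of_mem_pref {k : ℕ} {x : Word} (hk : 2 ≤ k) (hx : k ≤ x.length)
    (h : x ∈ Pref (kstar (Sk k))) :
    ∃ n, (n = k ∨ n = k - 1) ∧ x.take n ∈ Sk k ∧ x.drop n ∈ Pref (kstar (Sk k)) := by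
  obtain ⟨z, L, hL, hz⟩ := h
  cases L with
  | nil =>
    have := congrArg List.length hz
    simp at this
    omega
  | cons y L =>
    simp only [List.mem_cons, forall_eq_or_imp] at hL
    have hy := length_of_mem_Sk hL.1
    have hle : y.length ≤ x.length := by omega
    rw [List.flatten_cons] at hz
    have h1 : x.take y.length = y := by
      have := congrArg (List.take y.length) hz
      simpa [List.take_append_of_le_length hle] using this.symm
    have h2 : x.drop y.length ++ z = L.flatten := by
      have := congrArg (List.drop y.length) hz
      simpa [List.drop_append_of_le_length hle] using this.symm
    exact ⟨y.length, hy, by rw [h1]; exact hL.1, z, L, hL.2, h2.symm⟩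

lemma length_u {k : ℕ} (hk : 1 ≤ k) : (u k).length = k := by
  simp [u]; omega

lemma length_v {k : ℕ} (hk : 1 ≤ k) : (v k).length = k := by
  simp [v]; omega

lemma Forbidden.add_of_not_occursAt {k : ℕ} {w : Word} {j : ℕ} (hk : 1 ≤ k)
    (hj : j + k ≤ w.length) (hu : ¬ OccursAt (u k) w j) (hv : ¬ OccursAt (v k) w j)
    (h : Forbidden (Sk k) w j) : Forbidden (Sk k) w (j + k) := by
  intro hd
  refine h (mem_pref_of_take (n := k) (Or.inl ⟨?_, ?_, ?_⟩) ?_)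
  · simp; omega
  · intro h'
    exact hu ⟨by rwa [length_u hk], by rwa [length_u hk]⟩
  · intro h'
    exact hv ⟨by rwa [length_v hk], by rwa [length_v hk]⟩
  · rwa [List.drop_drop]

lemma Forbidden.of_add {k : ℕ} {w : Word} {j : ℕ} (hk : 2 ≤ k) (hj : j + k ≤ w.length)
    (h₁ : Forbidden (Sk k) w (j + k)) (h₂ : Forbidden (Sk k) w (j + (k - 1))) :
    Forbidden (Sk k) w j := by
  intro h
  obtain ⟨n, rfl | rfl, -, hd⟩ :=
    exists_take_mem_of_mem_pref hk (by rw [List.length_drop]; omega) h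
  · exact h₁ (by rwa [List.drop_drop] at hd)
  · exact h₂ (by rwa [List.drop_drop] at hd)

lemma Forbidden.add_pred_of_occursAt_u {k : ℕ} {w : Word} {s : ℕ} (hk : 3 ≤ k)
    (hs : OccursAt (u k) w s) (h : Forbidden (Sk k) w s) :
    Forbidden (Sk k) w (s + (k - 1)) := by
  intro hd
  obtain ⟨k, rfl⟩ : ∃ l, k = l + 3 := ⟨k - 3, by omega⟩
  obtain ⟨hlen, heq⟩ := hs
  rw [length_u (by omega)] at hlen heq
  have htake : (w.drop s).take (k + 3 - 1) = b :: List.replicate (k + 1) a := by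
    have := congrArg (List.take (k + 2)) heq
    simpa [List.take_take, u] using this
  refine h (mem_pref_of_take (n := k + 3 - 1) (Or.inr ?_) (by rwa [List.drop_drop]))
  rw [htake]
  refine ⟨by simp, ?_, ?_⟩
  · simp [List.replicate_succ, a, b]
  · simp [List.replicate_succ, a, b]

/-- Position of offset `x` of one occurrence, read modulo `k` from an occurrence lying
`r` further to the right. -/
def shiftMod (k r x : ℕ) : ℕ := if x < r then x + k - r else x - r

lemma shiftMod_injOn {k r : ℕ} (hr : r < k) : Set.InjOn (shiftMod k r) (Set.Iio k) := by
  intro x hx y hy h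
  simp only [Set.mem_Iio, shiftMod] at *
  split_ifs at h <;> omega

lemma exists_shiftMod_eq {k r y : ℕ} (hr : r < k) (hy : y < k) :
    ∃ x < k, shiftMod k r x = y := by
  unfold shiftMod
  by_cases h : y + r < k
  · exact ⟨y + r, h, by split_ifs <;> omega⟩
  · exact ⟨y + r - k, by omega, by split_ifs <;> omega⟩

lemma exists_add_mul_eq_shiftMod {k r s q : ℕ} (hr : r < k) (x : ℕ) :
    ∃ m, s + x + k * m = s + r + k * q + shiftMod k r x := by
  unfold shiftMod
  split_ifs
  · exact ⟨q + 1, by rw [mul_add]; omega⟩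
  · exact ⟨q, by omega⟩

lemma add_mul_of_step {P : ℕ → Prop} {k s t : ℕ}
    (hstep : ∀ j, s < j → j < t → P j → P (j + k)) {j : ℕ} (hj : s < j) (h : P j) (m : ℕ)
    (hm : j + k * m < t + k) : P (j + k * m) := by
  induction m with
  | zero => simpa
  | succ m ih =>
    rw [mul_add, mul_one] at hm ⊢
    rw [← add_assoc]
    exact hstep _ (by have := Nat.zero_le (k * m); omega) (by omega) (ih (by omega))

lemma not_of_lost {P : ℕ → Prop} {k s t : ℕ} (hk : 1 ≤ k)
    (hstep : ∀ j, s < j → j < t → P j → P (j + k))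
    (hback : ∀ j, s < j → j < t → P (j + k) → P (j + (k - 1)) → P j)
    {j : ℕ} (hj : s + 1 < j) (h : ¬ P j) {m : ℕ} (hm : j + k * m < t + k)
    (hP : P (j + k * m)) : ¬ P (j - 1) := by
  intro h'
  induction m with
  | zero => exact h hP
  | succ m ih =>
    have hprev := add_mul_of_step hstep (j := j - 1) (by omega) h' (m + 1) (by omega)
    rw [mul_add, mul_one] at hm hP hprev
    refine ih (by omega) (hback _ (by have := Nat.zero_le (k * m); omega) (by omega) ?_ ?_)
    · rwa [add_assoc]
    · convert hprev using 1
      omega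

lemma mem_image_add_mod_iff {k f m x : ℕ} (hx : x < k) :
    x ∈ (fun l => (f + l) % k) '' Set.Iio m ↔
      f % k ≤ x ∧ x < f % k + m ∨ x < f % k ∧ x + k < f % k + m := by
  have hk : 0 < k := by omega
  have hf := Nat.mod_lt f hk
  constructor
  · rintro ⟨l, hl, h⟩
    simp only [Set.mem_Iio] at hl h
    rw [Nat.add_mod] at h
    have hl' := Nat.mod_lt l hk
    have hle := Nat.mod_le l k
    by_cases hc : f % k + l % k < k
    · rw [Nat.mod_eq_of_lt hc] at h
      omega
    · rw [Nat.mod_eq_sub_mod (by omega), Nat.mod_eq_of_lt (by omega)] at h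
      omega
  · rintro (⟨h1, h2⟩ | ⟨h1, h2⟩)
    · refine ⟨x - f % k, by simp only [Set.mem_Iio]; omega, ?_⟩
      simp only
      rw [Nat.add_mod, Nat.mod_eq_of_lt (a := x - f % k) (by omega),
        Nat.mod_eq_of_lt (by omega)]
      omega
    · refine ⟨x + k - f % k, by simp only [Set.mem_Iio]; omega, ?_⟩
      simp only
      rw [Nat.add_mod, Nat.mod_eq_of_lt (a := x + k - f % k) (by omega),
        show f % k + (x + k - f % k) = x + k by omega, Nat.add_mod_right, Nat.mod_eq_of_lt hx]

lemma not_block_of_shiftMod {A : ℕ → Prop} {k i r f m : ℕ} (hi1 : 1 < i) (hi2 : i ≤ k - 2)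
    (hr : r < k)
    (hA : ∀ x < k, A x ↔ shiftMod k r x = 0 ∨ i ≤ shiftMod k r x ∧ shiftMod k r x ≤ k - 2)
    (hblock : ∀ x < k, A x ↔ f ≤ x ∧ x < f + m ∨ x < f ∧ x + k < f + m) : False := by
  obtain ⟨x₀, h₀, e₀⟩ := exists_shiftMod_eq hr (show 0 < k by omega)
  obtain ⟨x₁, h₁, e₁⟩ := exists_shiftMod_eq hr (show 1 < k by omega)
  obtain ⟨x₂, h₂, e₂⟩ := exists_shiftMod_eq hr (show i < k by omega)
  obtain ⟨x₃, h₃, e₃⟩ := exists_shiftMod_eq hr (show k - 1 < k by omega)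
  have a₀ := (hblock x₀ h₀).symm.trans (hA x₀ h₀)
  have a₁ := (hblock x₁ h₁).symm.trans (hA x₁ h₁)
  have a₂ := (hblock x₂ h₂).symm.trans (hA x₂ h₂)
  have a₃ := (hblock x₃ h₃).symm.trans (hA x₃ h₃)
  rw [e₀] at a₀
  rw [e₁] at a₁
  rw [e₂] at a₂
  rw [e₃] at a₃
  unfold shiftMod at e₀ e₁ e₂ e₃
  clear hA hblock
  split_ifs at e₀ e₁ e₂ e₃ <;> omega

lemma image_shiftMod {k r : ℕ} (hr : r < k) :
    (Finset.range k).image (shiftMod k r) = Finset.range k := by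
  ext y
  simp only [Finset.mem_image, Finset.mem_range]
  constructor
  · rintro ⟨x, hx, rfl⟩
    unfold shiftMod
    split_ifs <;> omega
  · exact exists_shiftMod_eq hr

/-- If `A` and `B` have equally many elements below `k` and `A` is carried into `B` by `shiftMod`
except possibly at `0`, then either `A` is the preimage of `B`, or it differs from it by containing
`0` and missing exactly one point. -/
lemma shiftMod_dichotomy {A B : ℕ → Prop} {k r : ℕ} (hr : r < k)
    (hcard : {x | x < k ∧ A x}.ncard = {x | x < k ∧ B x}.ncard)
    (hAB : ∀ x < k, x ≠ 0 → A x → B (shiftMod k r x)) :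
    (∀ x < k, A x ↔ B (shiftMod k r x)) ∨
    (A 0 ∧ ¬ B (shiftMod k r 0) ∧ ∃ x₀ < k, x₀ ≠ 0 ∧ B (shiftMod k r x₀) ∧ ¬ A x₀ ∧
      ∀ x < k, x ≠ 0 → x ≠ x₀ → (A x ↔ B (shiftMod k r x))) := by
  classical
  have hset (Q : ℕ → Prop) :
      {x | x < k ∧ Q x}.ncard = ((Finset.range k).filter Q).card := by
    rw [← Set.ncard_coe_finset]
    congr 1
    ext x
    simp
  set E := (Finset.range k).filter A with hE
  set C := (Finset.range k).filter (fun x => B (shiftMod k r x)) with hC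
  have hinj : Set.InjOn (shiftMod k r) C := (shiftMod_injOn hr).mono fun x hx => by
    simp [hC] at hx
    simpa using hx.1
  have hEC : E.card = C.card := by
    have himg := Finset.filter_image (s := Finset.range k) (f := shiftMod k r) (p := B)
    rw [image_shiftMod hr] at himg
    rw [hE, ← hset, hcard, hset, ← Finset.card_image_of_injOn hinj, himg]
  have hk : 0 < k := by omega
  by_cases h0 : A 0 → B (shiftMod k r 0)
  · left
    have hsub : E ⊆ C := by
      intro x hx
      simp only [hE, hC, Finset.mem_filter, Finset.mem_range] at hx ⊢
      refine ⟨hx.1, ?_⟩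
      rcases eq_or_ne x 0 with rfl | hne
      · exact h0 hx.2
      · exact hAB x hx.1 hne hx.2
    have heq := Finset.eq_of_subset_of_card_le hsub hEC.ge
    intro x hx
    simpa [hE, hC, hx] using Finset.ext_iff.1 heq x
  · right
    push Not at h0
    have hdiff : E \ C = {0} := by
      ext x
      simp only [hE, hC, Finset.mem_sdiff, Finset.mem_filter, Finset.mem_range,
        Finset.mem_singleton]
      constructor
      · rintro ⟨⟨hx, hAx⟩, hBx⟩
        by_contra hne
        exact hBx ⟨hx, hAB x hx hne hAx⟩
      · rintro rfl
        exact ⟨⟨hk, h0.1⟩, fun h => h0.2 h.2⟩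
    have hone : (C \ E).card = 1 := by
      rw [Finset.card_sdiff_comm hEC.symm, hdiff, Finset.card_singleton]
    obtain ⟨x₀, hx₀⟩ := Finset.card_eq_one.1 hone
    have hmem (x : ℕ) (hx : x < k) : B (shiftMod k r x) ∧ ¬ A x ↔ x = x₀ := by
      simpa [hE, hC, hx] using Finset.ext_iff.1 hx₀ x
    have hlt : x₀ < k := by
      have : x₀ ∈ C \ E := by simp [hx₀]
      simp [hC] at this
      exact this.1.1
    obtain ⟨hB, hA⟩ := (hmem x₀ hlt).2 rfl
    refine ⟨h0.1, h0.2, x₀, hlt, fun h => hA (h ▸ h0.1), hB, hA, fun x hx hne hne' => ?_⟩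
    refine ⟨hAB x hx hne, fun h => ?_⟩
    by_contra hAx
    exact hne' ((hmem x hx).1 ⟨h, hAx⟩)

/-- The conclusion on the shape of `A` once the point lost on the way from `B` is the left end of
one of the two blocks of `B`. -/
lemma shape_of_shiftMod {A : ℕ → Prop} {k i r f m x₀ : ℕ} (hi1 : 1 < i) (hi2 : i ≤ k - 2)
    (hr : r < k) (h0 : A 0) (hlast : A (k - 1)) (hx₀ : x₀ < k) (hne : x₀ ≠ 0) (hnA : ¬ A x₀)
    (hend : shiftMod k r x₀ = 0 ∨ shiftMod k r x₀ = i)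
    (hout : ¬ (shiftMod k r 0 = 0 ∨ i ≤ shiftMod k r 0 ∧ shiftMod k r 0 ≤ k - 2))
    (hA : ∀ x < k, x ≠ 0 → x ≠ x₀ →
      (A x ↔ shiftMod k r x = 0 ∨ i ≤ shiftMod k r x ∧ shiftMod k r x ≤ k - 2))
    (hblock : ∀ x < k, A x ↔ f ≤ x ∧ x < f + m ∨ x < f ∧ x + k < f + m) :
    (∀ x < k, A x ↔ x = 0 ∨ x = 1 ∨ i + 2 ≤ x) ∨ (∀ x < k, A x ↔ x = 0 ∨ i + 1 ≤ x) := by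
  have hl : k - 1 ≠ x₀ := fun h => hnA (h ▸ hlast)
  have al := (hA (k - 1) (by omega) (by omega) hl).1 hlast
  have hcase : (r = 1 ∧ x₀ = 1) ∨ (r = 1 ∧ x₀ = i + 1) ∨ (r = k - 1 ∧ x₀ = i - 1) := by
    clear hA hblock
    unfold shiftMod at *
    split_ifs at * <;> omega
  rcases hcase with ⟨rfl, rfl⟩ | ⟨rfl, rfl⟩ | ⟨rfl, rfl⟩
  · right
    intro x hx
    rcases eq_or_ne x 0 with rfl | h1
    · simpa using h0
    rcases eq_or_ne x 1 with rfl | h2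
    · simp only [hnA, false_iff]
      omega
    rw [hA x hx h1 h2]
    unfold shiftMod
    split_ifs <;> omega
  · left
    intro x hx
    rcases eq_or_ne x 0 with rfl | h1
    · simpa using h0
    rcases eq_or_ne x (i + 1) with rfl | h2
    · simp only [hnA, false_iff]
      omega
    rw [hA x hx h1 h2]
    unfold shiftMod
    split_ifs <;> omega
  · have hA' (x : ℕ) (hx : x < k - 1) (h1 : x ≠ 0) (h2 : x ≠ i - 1) :
        A x ↔ i ≤ x ∧ x ≤ k - 3 := by
      rw [hA x (by omega) h1 h2]
      unfold shiftMod
      split_ifs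
      omega
    obtain rfl | hik := eq_or_lt_of_le hi2
    · right
      intro x hx
      rcases eq_or_ne x 0 with rfl | h1
      · simpa using h0
      rcases eq_or_ne x (k - 2 - 1) with rfl | h2
      · simp only [hnA, false_iff]
        omega
      rcases eq_or_ne x (k - 1) with rfl | h3
      · simp only [hlast, true_iff]
        omega
      rw [hA' x (by omega) h1 h2]
      omega
    · have b₀ := (hblock 0 (by omega)).1 h0
      have b₁ := (hblock i (by omega)).1 ((hA' i (by omega) (by omega) (by omega)).2 (by omega))
      have b₂ := mt (hblock (i - 1) hx₀).2 hnA
      have b₃ := mt (hblock (k - 2) (by omega)).2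
        (mt (hA' (k - 2) (by omega) (by omega) (by omega)).1 (by omega))
      omega

lemma shape_of_step {P : ℕ → Prop} {k i s t f m : ℕ} (hi1 : 1 < i)
    (hi2 : i ≤ k - 2) (hst : s < t)
    (hstep : ∀ j, s < j → j < t → P j → P (j + k))
    (hback : ∀ j, s < j → j < t → P (j + k) → P (j + (k - 1)) → P j)
    (hfirst : P s → P (s + (k - 1)))
    (ht : ∀ y < k, P (t + y) ↔ y = 0 ∨ i ≤ y ∧ y ≤ k - 2)
    (hcard : {x | x < k ∧ P (s + x)}.ncard = {x | x < k ∧ P (t + x)}.ncard)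
    (hblock : ∀ x < k, P (s + x) ↔ f ≤ x ∧ x < f + m ∨ x < f ∧ x + k < f + m) :
    (∀ x < k, P (s + x) ↔ x = 0 ∨ x = 1 ∨ i + 2 ≤ x) ∨
    (∀ x < k, P (s + x) ↔ x = 0 ∨ i + 1 ≤ x) := by
  obtain ⟨r, q, hr, rfl⟩ : ∃ r q, r < k ∧ t = s + r + k * q :=
    ⟨(t - s) % k, (t - s) / k, Nat.mod_lt _ (by omega), by
      have := Nat.mod_add_div (t - s) k
      omega⟩
  have hlt (x : ℕ) (hx : x < k) : shiftMod k r x < k := by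
    unfold shiftMod
    split_ifs <;> omega
  have hAB (x : ℕ) (hx : x < k) (hne : x ≠ 0) (h : P (s + x)) :
      P (s + r + k * q + shiftMod k r x) := by
    obtain ⟨n, hn⟩ := exists_add_mul_eq_shiftMod (s := s) (q := q) hr x
    rw [← hn]
    exact add_mul_of_step hstep (by omega) h n (by have := hlt x hx; omega)
  rcases shiftMod_dichotomy (A := fun x => P (s + x)) (B := fun y => P (s + r + k * q + y))
    hr hcard hAB with h | ⟨h0, hout, x₀, hx₀, hne, hB, hnA, h⟩
  · exact (not_block_of_shiftMod (A := fun x => P (s + x)) hi1 hi2 hr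
      (fun x hx => (h x hx).trans (ht _ (hlt x hx))) hblock).elim
  · refine shape_of_shiftMod (A := fun x => P (s + x)) hi1 hi2 hr h0 (hfirst h0) hx₀ hne hnA ?_
      (fun h' => hout ((ht _ (hlt 0 (by omega))).2 h'))
      (fun x hx h1 h2 => (h x hx h1 h2).trans (ht _ (hlt x hx))) hblock
    by_contra! hend
    have hb := (ht _ (hlt x₀ hx₀)).1 hB
    have hpred : shiftMod k r (x₀ - 1) = shiftMod k r x₀ - 1 := by
      unfold shiftMod at hend hb ⊢
      split_ifs at * <;> omega
    have hB' : P (s + r + k * q + shiftMod k r (x₀ - 1)) :=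
      (ht _ (hlt _ (by omega))).2 (by omega)
    have hne' : x₀ - 1 ≠ 0 := fun h' => hout (h' ▸ hB')
    have hA' := (h (x₀ - 1) (by omega) hne' (by omega)).2 hB'
    obtain ⟨n, hn⟩ := exists_add_mul_eq_shiftMod (s := s) (q := q) hr x₀
    refine not_of_lost (by omega) hstep hback (j := s + x₀) (by omega) hnA (m := n)
      (by rw [hn]; have := hlt x₀ hx₀; omega) (by rwa [hn]) ?_
    rwa [Nat.add_sub_assoc (by omega)]

theorem statement17 (k : ℕ) (hk : 4 ≤ k) (w : Word)
    (s t : ℕ) (hop : OccursAt (u k) w s) (hoq : OccursAt (v k) w t)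
    (hcons : Consecutive k w s t)
    (i : ℕ) (hi1 : 1 < i) (hi2 : i ≤ k - 2)
    (hFq : Focc k w (v k) t = insert 0 (Set.Icc i (k - 2)))
    (hcard : (Focc k w (u k) s).ncard = (Focc k w (v k) t).ncard)
    (hblock : ∃ f m : ℕ, Focc k w (u k) s = (fun l => (f + l) % k) '' Set.Iio m) :
    Focc k w (u k) s = {0, 1} ∪ Set.Icc (i + 2) (k - 1) ∨
    Focc k w (u k) s = insert 0 (Set.Icc (i + 1) (k - 1)) := by
  have hu : (u k).length = k := length_u (by omega)
  have hv : (v k).length = k := length_v (by omega)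
  have hlen : t + k ≤ w.length := by simpa [hv] using hoq.1
  obtain ⟨f, m, hfm⟩ := hblock
  have hFp : Focc k w (u k) s = {x | x < k ∧ Forbidden (Sk k) w (s + x)} := by
    simp [Focc, hu]
  have hFv : Focc k w (v k) t = {x | x < k ∧ Forbidden (Sk k) w (t + x)} := by
    simp [Focc, hv]
  have hmem (x : ℕ) (hx : x < k) : x ∈ Focc k w (u k) s ↔ Forbidden (Sk k) w (s + x) := by
    simp [hFp, hx]
  have key := shape_of_step (P := Forbidden (Sk k) w) (f := f % k) (m := m) hi1 hi2 hcons.1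
    (fun j h1 h2 h => h.add_of_not_occursAt (by omega) (by omega) (hcons.2 j h1 h2).1
      (hcons.2 j h1 h2).2)
    (fun j _ h2 h h' => h.of_add (by omega) (by omega) h')
    (fun h => h.add_pred_of_occursAt_u (by omega) hop)
    (fun y hy => by
      have := Set.ext_iff.1 hFq y
      rw [hFv] at this
      simpa [hy] using this)
    (by rwa [← hFp, ← hFv])
    (fun x hx => by rw [← hmem x hx, hfm, mem_image_add_mod_iff hx])
  refine key.imp (fun h => ?_) (fun h => ?_)
  · ext x
    by_cases hx : x < k
    · rw [hmem x hx, h x hx]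
      simp only [Set.mem_union, Set.mem_insert_iff, Set.mem_singleton_iff, Set.mem_Icc]
      omega
    · simp only [hFp, Set.mem_ofPred_eq, Set.mem_union, Set.mem_insert_iff,
        Set.mem_singleton_iff, Set.mem_Icc, hx, false_and, false_iff]
      omega
  · ext x
    by_cases hx : x < k
    · rw [hmem x hx, h x hx]
      simp only [Set.mem_insert_iff, Set.mem_Icc]
      omega
    · simp only [hFp, Set.mem_ofPred_eq, Set.mem_insert_iff, Set.mem_Icc, hx, false_and,
        false_iff]
      omega

end Restivo
end

section
/- Let k ≥ 4 and let w be a minimal uncompletable word for S_k. Then w has a prefix of the form u y b^{k−2} u, where y is a word with |y| ≡ 1 (mod k), and w has a suffix of the form v a^{k−2} ŷ v, where ŷ is a word with |ŷ| ≡ 1 (mod k). -/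
namespace Restivo

/-- The word `u k` occurs at position `j`, expressed letter by letter. -/
def AtU (k : ℕ) (w : Word) (j : ℕ) : Prop :=
  w[j]? = some b ∧ ∀ i, j < i → i < j + k → w[i]? = some a

/-- The word `v k` occurs at position `j`, expressed letter by letter. -/
def AtV (k : ℕ) (w : Word) (j : ℕ) : Prop :=
  w[j + k - 1]? = some a ∧ ∀ i, j ≤ i → i + 1 < j + k → w[i]? = some b

/-- The word `c ^ (k - 1)` occurs at position `j`. -/
def AtRun (k : ℕ) (c : Bool) (w : Word) (j : ℕ) : Prop :=
  ∀ i, j ≤ i → i + 1 < j + k → w[i]? = some c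

lemma a_ne_b : a ≠ b := by decide

lemma take_drop_eq_iff {w p : Word} {j n : ℕ} (hp : p.length = n) :
    (w.drop j).take n = p ↔ ∀ i < n, w[j + i]? = p[i]? := by
  constructor
  · rintro rfl i hi
    simp [hi]
  · intro h
    apply List.ext_getElem?
    intro i
    by_cases hi : i < n
    · simp [hi, h i hi]
    · rw [List.getElem?_eq_none (by simp; omega), List.getElem?_eq_none (by omega)]

lemma u_length {k : ℕ} (hk : 4 ≤ k) : (u k).length = k := by simp [u]; omega

lemma v_length {k : ℕ} (hk : 4 ≤ k) : (v k).length = k := by simp [v]; omega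

lemma atU_iff {k : ℕ} (hk : 4 ≤ k) {w : Word} {j : ℕ} :
    AtU k w j ↔ (w.drop j).take k = u k := by
  rw [take_drop_eq_iff (u_length hk)]
  constructor
  · rintro ⟨h0, h⟩ i hi
    rcases i with _ | i
    · simpa [u] using h0
    · rw [h _ (by omega) (by omega)]
      simp [u, List.getElem?_replicate]; omega
  · intro h
    refine ⟨by simpa [u] using h 0 (by omega), fun i h1 h2 => ?_⟩
    obtain ⟨d, rfl⟩ : ∃ d, i = j + (d + 1) := ⟨i - j - 1, by omega⟩
    rw [h (d + 1) (by omega)]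
    simp [u, List.getElem?_replicate]; omega

lemma v_getElem? {k i : ℕ} (hk : 4 ≤ k) (hi : i < k) :
    (v k)[i]? = if i + 1 = k then some a else some b := by
  split_ifs with h
  · rw [v, List.getElem?_append_right (by simp; omega)]
    simp [show i - (k - 1) = 0 by omega]
  · rw [v, List.getElem?_append_left (by simp; omega)]
    simp [List.getElem?_replicate]; omega

lemma atV_iff {k : ℕ} (hk : 4 ≤ k) {w : Word} {j : ℕ} :
    AtV k w j ↔ (w.drop j).take k = v k := by
  rw [take_drop_eq_iff (v_length hk)]
  constructor
  · rintro ⟨h0, h⟩ i hi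
    rw [v_getElem? hk hi]
    split_ifs with h1
    · rw [← h0]; congr 1; omega
    · exact h _ (by omega) (by omega)
  · intro h
    refine ⟨?_, fun i h1 h2 => ?_⟩
    · rw [show j + k - 1 = j + (k - 1) by omega, h _ (by omega), v_getElem? hk (by omega),
        if_pos (by omega)]
    · obtain ⟨d, rfl⟩ : ∃ d, i = j + d := ⟨i - j, by omega⟩
      rw [h d (by omega), v_getElem? hk (by omega), if_neg (by omega)]

lemma atRun_iff {k : ℕ} {c : Bool} {w : Word} {j : ℕ} :
    AtRun k c w j ↔ (w.drop j).take (k - 1) = List.replicate (k - 1) c := by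
  rw [take_drop_eq_iff (by simp)]
  constructor
  · intro h i hi
    rw [h _ (by omega) (by omega)]
    simp [List.getElem?_replicate]; omega
  · intro h i h1 h2
    obtain ⟨d, rfl⟩ : ∃ d, i = j + d := ⟨i - j, by omega⟩
    rw [h d (by omega)]
    simp [List.getElem?_replicate]; omega

lemma nil_mem_kstar (S : Set Word) : [] ∈ kstar S := ⟨[], by simp, rfl⟩

lemma append_mem_kstar {S : Set Word} {x y : Word} (hx : x ∈ S) (hy : y ∈ kstar S) :
    x ++ y ∈ kstar S := by
  obtain ⟨L, hL, rfl⟩ := hy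
  exact ⟨x :: L, by simpa [hx] using hL, rfl⟩

lemma nil_mem_Pref_kstar (S : Set Word) : [] ∈ Pref (kstar S) :=
  ⟨[], by simpa using nil_mem_kstar S⟩

lemma append_mem_Pref_kstar {S : Set Word} {x y : Word} (hx : x ∈ S) (hy : y ∈ Pref (kstar S)) :
    x ++ y ∈ Pref (kstar S) := by
  obtain ⟨z, hz⟩ := hy
  exact ⟨z, by simpa using append_mem_kstar hx hz⟩

lemma mem_Sk_of_getLast {k : ℕ} (hk : 4 ≤ k) {x : Word} (hx : x.length + 1 = k) :
    x ++ [b] ∈ Sk k := by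
  left
  refine ⟨by simp [hx], fun h => ?_, fun h => ?_⟩
  · have := congrArg List.getLast? h
    rw [u, show k - 1 = (k - 2) + 1 by omega, List.replicate_succ', ← List.cons_append] at this
    simp at this
    exact a_ne_b (by simpa [List.getLast?_cons] using this.symm)
  · have := congrArg List.getLast? h
    simp [v] at this
    exact a_ne_b this.symm

lemma mem_Sk_of_head {k : ℕ} (hk : 4 ≤ k) {x : Word} (hx : x.length + 1 = k) :
    a :: x ∈ Sk k := by
  left
  refine ⟨by simp [hx], fun h => ?_, fun h => ?_⟩
  · simp [u] at h
    exact a_ne_b h.1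
  · rw [v, show k - 1 = (k - 2) + 1 by omega, List.replicate_succ] at h
    simp at h
    exact a_ne_b h.1

lemma mem_Pref_of_length_lt {k : ℕ} (hk : 4 ≤ k) {x : Word} (hx : x.length < k) :
    x ∈ Pref (kstar (Sk k)) := by
  refine ⟨List.replicate (k - 1 - x.length) a ++ [b], ?_⟩
  have := append_mem_kstar (mem_Sk_of_getLast hk
    (x := x ++ List.replicate (k - 1 - x.length) a) (by simp; omega)) (nil_mem_kstar (Sk k))
  simpa using this

lemma mem_Pref_iff {k : ℕ} (hk : 4 ≤ k) {q : Word} (hq : k ≤ q.length) :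
    q ∈ Pref (kstar (Sk k)) ↔
      (q.drop k ∈ Pref (kstar (Sk k)) ∧ q.take k ≠ u k ∧ q.take k ≠ v k) ∨
      (q.drop (k - 1) ∈ Pref (kstar (Sk k)) ∧ q.take (k - 1) ≠ List.replicate (k - 1) a ∧
        q.take (k - 1) ≠ List.replicate (k - 1) b) := by
  constructor
  · rintro ⟨z, L, hL, hz⟩
    rcases L with _ | ⟨x, L⟩
    · have := congrArg List.length hz
      simp at this; omega
    have hx := hL x (by simp)
    have hL' : L.flatten ∈ kstar (Sk k) := ⟨L, fun y hy => hL y (by simp [hy]), rfl⟩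
    rw [List.flatten_cons] at hz
    have key : ∀ n, x.length = n → n ≤ q.length →
        q.take n = x ∧ q.drop n ∈ Pref (kstar (Sk k)) := by
      rintro n rfl hn
      have h1 := congrArg (List.take x.length) hz
      have h2 := congrArg (List.drop x.length) hz
      rw [List.take_left, List.take_append_of_le_length hn] at h1
      rw [List.drop_left, List.drop_append_of_le_length hn] at h2
      exact ⟨h1.symm, z, h2 ▸ hL'⟩
    rcases hx with ⟨h1, h2, h3⟩ | ⟨h1, h2, h3⟩
    · obtain ⟨e, h⟩ := key _ h1 hq
      exact Or.inl ⟨h, e ▸ h2, e ▸ h3⟩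
    · obtain ⟨e, h⟩ := key _ h1 (by omega)
      exact Or.inr ⟨h, e ▸ h2, e ▸ h3⟩
  · rintro (⟨h1, h2⟩ | ⟨h1, h2⟩)
    · rw [← List.take_append_drop k q]
      exact append_mem_Pref_kstar (Or.inl ⟨by simp; omega, h2⟩) h1
    · rw [← List.take_append_drop (k - 1) q]
      exact append_mem_Pref_kstar (Or.inr ⟨by simp; omega, h2⟩) h1

lemma Forbidden.add_le_length {k : ℕ} (hk : 4 ≤ k) {w : Word} {j : ℕ}
    (h : Forbidden (Sk k) w j) : j + k ≤ w.length := by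
  by_contra hj
  exact h (mem_Pref_of_length_lt hk (by simp; omega))

/-- Backward recursion for forbidden positions. -/
lemma forbidden_iff {k : ℕ} (hk : 4 ≤ k) {w : Word} {j : ℕ} :
    Forbidden (Sk k) w j ↔
      (Forbidden (Sk k) w (j + k) ∨ AtU k w j ∨ AtV k w j) ∧
      (Forbidden (Sk k) w (j + k - 1) ∨ AtRun k a w j ∨ AtRun k b w j) := by
  by_cases hj : j + k ≤ w.length
  · rw [atU_iff hk, atV_iff hk, atRun_iff, atRun_iff]
    unfold Forbidden
    rw [mem_Pref_iff hk (by simp; omega), List.drop_drop, List.drop_drop,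
      show j + (k - 1) = j + k - 1 by omega]
    tauto
  · have hnone : w[j + k - 1]? = none := List.getElem?_eq_none (by omega)
    constructor
    · intro h
      exact absurd (h.add_le_length hk) hj
    · rintro ⟨h | h | h, -⟩
      · have := h.add_le_length hk
        omega
      · have := h.2 (j + k - 1) (by omega) (by omega)
        simp [hnone] at this
      · have := h.1
        simp [hnone] at this

lemma forbidden_of_atV {k : ℕ} (hk : 4 ≤ k) {w : Word} {j : ℕ} (h : AtV k w j) :
    Forbidden (Sk k) w j :=
  (forbidden_iff hk).2 ⟨Or.inr (Or.inr h), Or.inr (Or.inr h.2)⟩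

lemma exists_drop_mem_Pref {S : Set Word} {k : ℕ} (hk : 0 < k) (hS : ∀ x ∈ S, x.length ≤ k)
    (w y : Word) (L : List Word) (hL : ∀ x ∈ L, x ∈ S) (x : Word)
    (h : L.flatten = x ++ w ++ y) : ∃ j < k, w.drop j ∈ Pref (kstar S) := by
  induction L generalizing x with
  | nil =>
    have hw : w = [] := by simp at h; tauto
    exact ⟨0, hk, by simpa [hw] using nil_mem_Pref_kstar S⟩
  | cons l L ih =>
    have hL' : ∀ x ∈ L, x ∈ S := fun y hy => hL y (by simp [hy])
    have hl := hS l (hL l (by simp))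
    rcases Nat.eq_zero_or_pos x.length with hx | hx
    · obtain rfl := List.length_eq_zero_iff.1 hx
      exact ⟨0, hk, y, l :: L, hL, by simpa using h⟩
    by_cases hlx : l.length ≤ x.length
    · refine ih hL' (x.drop l.length) ?_
      have := congrArg (List.drop l.length) h
      rw [List.flatten_cons, List.drop_left, List.append_assoc,
        List.drop_append_of_le_length hlx] at this
      simpa using this
    · refine ⟨l.length - x.length, by omega, ?_⟩
      by_cases hw : l.length - x.length ≤ w.length
      · refine ⟨y, L, hL', ?_⟩
        have := congrArg (List.drop l.length) h
        rw [List.flatten_cons, List.drop_left, List.append_assoc, List.drop_append,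
          List.drop_eq_nil_of_le (by omega), List.drop_append_of_le_length hw] at this
        simpa using this
      · rw [List.drop_eq_nil_of_le (by omega)]
        exact nil_mem_Pref_kstar S

lemma length_le_of_mem_Sk {k : ℕ} : ∀ x ∈ Sk k, x.length ≤ k := by
  rintro x (h | h)
  · exact h.1.le
  · rw [h.1]; omega

lemma notMem_Facts_iff {k : ℕ} (hk : 4 ≤ k) {w : Word} :
    w ∉ Facts (kstar (Sk k)) ↔ ∀ j < k, Forbidden (Sk k) w j := by
  constructor
  · rintro h j hj ⟨z, hz⟩
    refine h ⟨a :: List.replicate (k - 1 - (w.take j).length) a, z, ?_⟩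
    have := append_mem_kstar (mem_Sk_of_head hk
      (x := List.replicate (k - 1 - (w.take j).length) a ++ w.take j)
      (by simp; omega)) hz
    have e := List.take_append_drop j w
    generalize List.replicate (k - 1 - (w.take j).length) a = r at *
    rw [show a :: r ++ w ++ z = a :: r ++ (w.take j ++ w.drop j) ++ z by rw [e]]
    simpa only [List.cons_append, List.append_assoc] using this
  · rintro h ⟨x, y, L, hL, e⟩
    obtain ⟨j, hj, hp⟩ := exists_drop_mem_Pref (by omega) length_le_of_mem_Sk w y L hL x e
    exact h j hj hp

lemma AtU.congr {k : ℕ} (hk : 4 ≤ k) {w w' : Word} {j : ℕ}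
    (e : ∀ i, j ≤ i → i < j + k → w'[i]? = w[i]?) (h : AtU k w j) : AtU k w' j :=
  ⟨by rw [e _ le_rfl (by omega), h.1], fun i h1 h2 => by rw [e _ h1.le h2, h.2 i h1 h2]⟩

lemma AtV.congr {k : ℕ} (hk : 4 ≤ k) {w w' : Word} {j : ℕ}
    (e : ∀ i, j ≤ i → i < j + k → w'[i]? = w[i]?) (h : AtV k w j) : AtV k w' j :=
  ⟨by rw [e _ (by omega) (by omega), h.1],
    fun i h1 h2 => by rw [e _ h1 (by omega), h.2 i h1 h2]⟩

lemma AtRun.congr {k : ℕ} {c : Bool} {w w' : Word} {j : ℕ}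
    (e : ∀ i, j ≤ i → i < j + k → w'[i]? = w[i]?) (h : AtRun k c w j) : AtRun k c w' j :=
  fun i h1 h2 => by rw [e _ h1 (by omega), h i h1 h2]

/-- A suffix of a minimal uncompletable word cannot be replaced by a shorter word which has the
same first `k - 1` letters and at least the same forbidden positions among the first `k`. -/
lemma MinUncompletable.no_shorter_suffix {k : ℕ} (hk : 4 ≤ k) {w : Word}
    (hw : MinUncompletable (Sk k) w) (t : ℕ) (q : Word) (hq : t + q.length < w.length)
    (hl : ∀ i, i + 1 < k → q[i]? = w[t + i]?)
    (hF : ∀ i < k, Forbidden (Sk k) w (t + i) → Forbidden (Sk k) q i) : False := by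
  have htl : (w.take t).length = t := by simp; omega
  have hlet : ∀ i, i + 1 < t + k → (w.take t ++ q)[i]? = w[i]? := by
    intro i hi
    by_cases h : i < t
    · rw [List.getElem?_append_left (by omega), List.getElem?_take, if_pos h]
    · rw [List.getElem?_append_right (by omega), htl, hl _ (by omega)]
      congr 1; omega
  have key : ∀ d j, j + d = t + k → 0 < d → Forbidden (Sk k) w j →
      Forbidden (Sk k) (w.take t ++ q) j := by
    intro d
    induction d using Nat.strong_induction_on with
    | _ d ih =>
      intro j hj hd h
      by_cases hjt : t ≤ j
      · obtain ⟨i, rfl⟩ := Nat.exists_eq_add_of_le hjt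
        have := hF i (by omega) h
        unfold Forbidden at this ⊢
        rwa [List.drop_append, List.drop_eq_nil_of_le (by omega), htl, Nat.add_sub_cancel_left,
          List.nil_append]
      · rw [forbidden_iff hk] at h ⊢
        have e : ∀ i, j ≤ i → i < j + k → (w.take t ++ q)[i]? = w[i]? :=
          fun i _ _ => hlet i (by omega)
        refine ⟨h.1.imp (ih (d - k) (by omega) _ (by omega) (by omega))
          (Or.imp (AtU.congr hk e) (AtV.congr hk e)),
          h.2.imp (ih (d - (k - 1)) (by omega) _ (by omega) (by omega))
          (Or.imp (AtRun.congr e) (AtRun.congr e))⟩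
  have := hw.2 (w.take t ++ q) ((notMem_Facts_iff hk).2 fun j hj =>
    key (t + k - j) j (by omega) (by omega) ((notMem_Facts_iff hk).1 hw.1 j hj))
  rw [List.length_append, htl] at this
  omega

lemma atV_append_v {k : ℕ} (hk : 4 ≤ k) (x : Word) : AtV k (x ++ v k) x.length := by
  rw [atV_iff hk, List.drop_left, List.take_of_length_le (v_length hk).le]

section Minimal

variable {k : ℕ} {w : Word}

lemma no_run_b_of_subset_singleton (hk : 4 ≤ k) (hw : MinUncompletable (Sk k) w) {t : ℕ}
    (ht : t + k < w.length) (hb : AtRun k b w t)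
    (hF : ∀ i, t < i → i < t + k → ¬ Forbidden (Sk k) w i) : False := by
  refine hw.no_shorter_suffix hk t (v k) (by rwa [v_length hk]) (fun i hi => ?_) fun i hi h => ?_
  · rw [v_getElem? hk (by omega), if_neg (by omega), hb _ (by omega) (by omega)]
  · obtain rfl : i = 0 := by
      by_contra h0
      exact hF _ (by omega) (by omega) h
    exact forbidden_of_atV hk (by simpa using atV_append_v hk [])

lemma no_run_a_of_subset_singleton (hk : 4 ≤ k) (hw : MinUncompletable (Sk k) w) {t : ℕ}
    (ht : t + 2 * k < w.length) (ha : AtRun k a w t)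
    (hF : ∀ i, t < i → i < t + k → ¬ Forbidden (Sk k) w i) : False := by
  have hlet : ∀ i, i < k → (List.replicate k a ++ v k)[i]? = some a := by
    intro i hi
    rw [List.getElem?_append_left (by simpa using hi)]
    simp [hi]
  refine hw.no_shorter_suffix hk t (List.replicate k a ++ v k) (by simp [v_length hk]; omega)
    (fun i hi => ?_) fun i hi h => ?_
  · rw [hlet i (by omega), ha _ (by omega) (by omega)]
  · obtain rfl : i = 0 := by
      by_contra h0
      exact hF _ (by omega) (by omega) h
    rw [forbidden_iff hk]
    have := forbidden_of_atV hk (atV_append_v hk (List.replicate k a))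
    rw [List.length_replicate] at this
    exact ⟨Or.inl (by simpa using this), Or.inr (Or.inl fun i _ _ => hlet i (by omega))⟩

lemma exists_forbidden_window (hk : 4 ≤ k) (hw : MinUncompletable (Sk k) w) {t : ℕ}
    (ht : t + k ≤ w.length) : ∃ i, t ≤ i ∧ i < t + k ∧ Forbidden (Sk k) w i := by
  by_contra! hF
  refine hw.no_shorter_suffix hk t ((w.drop t).take (k - 1)) (by simp; omega)
    (fun i hi => ?_) fun i hi h => absurd h (hF _ (by omega) (by omega))
  rw [List.getElem?_take, if_pos (by omega), List.getElem?_drop]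

lemma no_subset_singleton (hk : 4 ≤ k) (hw : MinUncompletable (Sk k) w) {t : ℕ}
    (ht : t + 2 * k < w.length)
    (hF : ∀ i, t < i → i < t + k → ¬ Forbidden (Sk k) w i) : False := by
  obtain ⟨i, h1, h2, h⟩ := exists_forbidden_window hk hw (t := t) (by omega)
  obtain rfl : i = t := by
    by_contra h0
    exact hF i (by omega) h2 h
  rcases ((forbidden_iff hk).1 h).2 with h | h | h
  · exact hF _ (by omega) (by omega) h
  · exact no_run_a_of_subset_singleton hk hw ht h hF
  · exact no_run_b_of_subset_singleton hk hw (by omega) h hF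

/-- Variant of `no_run_b_of_subset_singleton` where two letters precede the run of `b`. -/
lemma no_run_b_of_subset_singleton_add_two (hk : 4 ≤ k) (hw : MinUncompletable (Sk k) w) {t : ℕ}
    (ht : t + 2 + k < w.length) (hb : AtRun k b w (t + 2))
    (hF : ∀ i, t ≤ i → i < t + k → Forbidden (Sk k) w i → i = t + 2) : False := by
  have hlen : ((w.drop t).take 2).length = 2 := by simp; omega
  refine hw.no_shorter_suffix hk t ((w.drop t).take 2 ++ v k)
    (by rw [List.length_append, hlen, v_length hk]; omega) (fun i hi => ?_) fun i hi h => ?_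
  · by_cases h2 : i < 2
    · rw [List.getElem?_append_left (by omega), List.getElem?_take, if_pos h2, List.getElem?_drop]
    · rw [List.getElem?_append_right (by omega), hlen, v_getElem? hk (by omega),
        if_neg (by omega), hb _ (by omega) (by omega)]
  · obtain rfl : i = 2 := by
      have := hF _ (by omega) (by omega) h
      omega
    have := atV_append_v hk ((w.drop t).take 2)
    rw [hlen] at this
    exact forbidden_of_atV hk this

lemma Forbidden.atV_of_maximal (hk : 4 ≤ k) {s : ℕ} (hs : Forbidden (Sk k) w s)
    (hmax : ∀ i, s < i → ¬ Forbidden (Sk k) w i) : AtV k w s := by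
  obtain ⟨h1, h2⟩ := (forbidden_iff hk).1 hs
  rcases h1 with h1 | h1 | h1
  · exact absurd h1 (hmax _ (by omega))
  · rcases h2 with h2 | h2 | h2
    · exact absurd h2 (hmax _ (by omega))
    · have := h2 s (by omega) (by omega)
      rw [h1.1] at this
      exact absurd (Option.some_injective _ this).symm a_ne_b
    · have := h2 (s + 1) (by omega) (by omega)
      rw [h1.2 _ (by omega) (by omega)] at this
      exact absurd (Option.some_injective _ this) a_ne_b
  · exact h1

lemma exists_final_v (hk : 4 ≤ k) (hw : MinUncompletable (Sk k) w) :
    ∃ s, s + k = w.length ∧ AtV k w s ∧ ∀ i, s < i → ¬ Forbidden (Sk k) w i := by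
  classical
  have h0 := (notMem_Facts_iff hk).1 hw.1 0 (by omega)
  have hb : ∀ i, Forbidden (Sk k) w i → i ≤ w.length := fun i h => by
    have := h.add_le_length hk
    omega
  let s := Nat.findGreatest (Forbidden (Sk k) w) w.length
  have hs : Forbidden (Sk k) w s := Nat.findGreatest_spec (Nat.zero_le _) h0
  have hmax : ∀ i, s < i → ¬ Forbidden (Sk k) w i := fun i hi h =>
    Nat.findGreatest_is_greatest hi (hb i h) h
  have hV := hs.atV_of_maximal hk hmax
  refine ⟨s, ?_, hV, hmax⟩
  by_contra hne
  have := hs.add_le_length hk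
  exact no_run_b_of_subset_singleton hk hw (t := s) (by omega) hV.2 fun i h _ => hmax i h

/-- No forbidden position can be created inside the `k - 1` positions preceding a factor which
starts with a long run of the letter `b`. -/
lemma forbidden_add_of_run_b (hk : 4 ≤ k) {t j : ℕ} (hb : AtRun k b w t) (h1 : t < j + k)
    (h2 : j < t) (h : Forbidden (Sk k) w j) : Forbidden (Sk k) w (j + k) := by
  have hl := hb (j + k - 1) (by omega) (by omega)
  rcases ((forbidden_iff hk).1 h).1 with h | h | h
  · exact h
  · have := h.2 (j + k - 1) (by omega) (by omega)
    rw [hl] at this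
    exact absurd (Option.some_injective _ this).symm a_ne_b
  · have := h.1
    rw [hl] at this
    exact absurd (Option.some_injective _ this).symm a_ne_b

lemma le_of_not_forbidden (hk : 4 ≤ k) (hw : MinUncompletable (Sk k) w) {j : ℕ}
    (h : ¬ Forbidden (Sk k) w j) : k ≤ j := by
  by_contra hj
  exact h ((notMem_Facts_iff hk).1 hw.1 j (by omega))

/-- The case of a word `b ^ (k - 2)` followed by `u k`, at a moment when the first letter of
this `u k` is the only forbidden position. -/
lemma no_v_overlapping_u (hk : 4 ≤ k) (hw : MinUncompletable (Sk k) w) {r : ℕ}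
    (hr : r + 3 * k ≤ w.length) (hU : AtU k w (r + k)) (hV : AtV k w (r + 2))
    (hF : ∀ i, r ≤ i → i < r + k → Forbidden (Sk k) w i → i = r ∨ i = r + 2)
    (hF' : ∀ i, r + k ≤ i + 1 → i + 1 < r + 2 * k → Forbidden (Sk k) w i → i = r + k) :
    False := by
  by_cases hr0 : Forbidden (Sk k) w r
  swap
  · refine no_run_b_of_subset_singleton_add_two hk hw (t := r) (by omega) hV.2
      fun i h1 h2 h => ?_
    rcases hF i h1 h2 h with rfl | h3
    · exact absurd h hr0
    · exact h3
  have hb : AtRun k b w r := by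
    rcases ((forbidden_iff hk).1 hr0).2 with h | h | h
    · have := hF' _ (by omega) (by omega) h
      omega
    · have h1 := h (r + 2) (by omega) (by omega)
      rw [hV.2 _ (by omega) (by omega)] at h1
      exact absurd (Option.some_injective _ h1).symm a_ne_b
    · exact h
  have hbb : ∀ i, r ≤ i → i ≤ r + k → w[i]? = some b := by
    intro i h1 h2
    by_cases h3 : i < r + 2
    · exact hb i h1 (by omega)
    · exact hV.2 i (by omega) (by omega)
  have hn1 : ¬ Forbidden (Sk k) w (r + 1) := fun h => by
    have := hF _ (by omega) (by omega) h
    omega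
  have hr1 := le_of_not_forbidden hk hw hn1
  have hprev : ∀ j, r < j + k → j < r → Forbidden (Sk k) w j → j + k = r + 2 := by
    intro j h1 h2 h
    have := forbidden_add_of_run_b hk hb h1 h2 h
    rcases hF _ (by omega) (by omega) this with h3 | h3 <;> omega
  have hr2 : k ≤ r - 1 := le_of_not_forbidden hk hw fun h => by
    have := hprev (r - 1) (by omega) (by omega) h
    omega
  obtain ⟨m, rfl⟩ : ∃ m, r = m + k := ⟨r - k, by omega⟩
  by_cases hm2 : Forbidden (Sk k) w (m + 2)
  swap
  · refine no_subset_singleton hk hw (t := m) (by omega) fun i h1 h2 h => ?_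
    have := hprev i (by omega) (by omega) h
    obtain rfl : i = m + 2 := by omega
    exact hm2 h
  have hbm2 : AtRun k b w (m + 2) := by
    rcases ((forbidden_iff hk).1 hm2).2 with h | h | h
    · exact absurd (by convert h using 1; omega) hn1
    · have h1 := h (m + k) (by omega) (by omega)
      rw [hbb _ (by omega) (by omega)] at h1
      exact absurd (Option.some_injective _ h1).symm a_ne_b
    · exact h
  by_cases hm : Forbidden (Sk k) w m
  swap
  · refine no_run_b_of_subset_singleton_add_two hk hw (t := m) (by omega) hbm2
      fun i h1 h2 h => ?_
    by_cases him : i = m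
    · exact absurd (him ▸ h) hm
    have := hprev i (by omega) (by omega) h
    omega
  have hbm : AtRun k b w m := by
    rcases ((forbidden_iff hk).1 hm).2 with h | h | h
    · have := hprev _ (by omega) (by omega) h
      omega
    · have h1 := h (m + 2) (by omega) (by omega)
      rw [hbm2 _ (by omega) (by omega)] at h1
      exact absurd (Option.some_injective _ h1).symm a_ne_b
    · exact h
  refine hw.no_shorter_suffix hk m (w.drop (m + k)) (by simp; omega) (fun i hi => ?_)
    fun i hi h => ?_
  · rw [List.getElem?_drop, hbb _ (by omega) (by omega), hbm _ (by omega) (by omega)]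
  · unfold Forbidden at hr0 ⊢
    rw [List.drop_drop]
    rcases Nat.eq_zero_or_pos i with rfl | h0
    · exact hr0
    · have := hprev _ (by omega) (by omega) h
      obtain rfl : i = 2 := by omega
      exact forbidden_of_atV hk hV

lemma exists_v_before_final_v (hk : 4 ≤ k) (hw : MinUncompletable (Sk k) w) :
    ∃ m, m + 3 * k = w.length + 1 ∧ AtV k w m ∧ AtRun k a w (m + k - 1) ∧
      AtV k w (m + 2 * k - 1) := by
  obtain ⟨s, hsl, hVs, hmax⟩ := exists_final_v hk hw
  have hs1 := le_of_not_forbidden hk hw (hmax (s + 1) (by omega))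
  have hF1 : ∀ j, s < j + k → j < s → ¬ Forbidden (Sk k) w j := fun j h1 h2 h =>
    hmax _ h1 (forbidden_add_of_run_b hk hVs.2 h1 h2 h)
  have hs2 := le_of_not_forbidden hk hw (hF1 (s - 1) (by omega) (by omega))
  obtain ⟨t, rfl⟩ : ∃ t, s = t + k := ⟨s - k, by omega⟩
  have hFt : ∀ j, t < j → j < t + k → ¬ Forbidden (Sk k) w j := fun j h1 h2 =>
    hF1 j (by omega) h2
  have ht : Forbidden (Sk k) w t := by
    obtain ⟨i, h1, h2, h⟩ := exists_forbidden_window hk hw (t := t) (by omega)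
    obtain rfl : i = t := by
      by_contra h0
      exact hFt i (by omega) h2 h
    exact h
  have ha : AtRun k a w t := by
    rcases ((forbidden_iff hk).1 ht).2 with h | h | h
    · exact absurd h (hFt _ (by omega) (by omega))
    · exact h
    · exact (no_run_b_of_subset_singleton hk hw (by omega) h hFt).elim
  have hprev : ∀ j, t < j + k → j < t → Forbidden (Sk k) w j →
      j + k = t + 1 ∧ (AtU k w j ∨ AtV k w j) := by
    intro j h1 h2 h
    obtain ⟨h3 | h3 | h3, h4⟩ := (forbidden_iff hk).1 h
    · exact absurd h3 (hFt _ h1 (by omega))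
    · refine ⟨?_, Or.inl h3⟩
      rcases h4 with h4 | h4 | h4
      · by_contra hne
        exact hFt _ (by omega) (by omega) h4
      · have := h4 j le_rfl (by omega)
        rw [h3.1] at this
        exact absurd (Option.some_injective _ this).symm a_ne_b
      · have := h4 (j + 1) (by omega) (by omega)
        rw [h3.2 _ (by omega) (by omega)] at this
        exact absurd (Option.some_injective _ this) a_ne_b
    · refine ⟨?_, Or.inr h3⟩
      by_contra hne
      have := ha (j + k - 2) (by omega) (by omega)
      rw [h3.2 _ (by omega) (by omega)] at this
      exact absurd (Option.some_injective _ this).symm a_ne_b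
  have ht1 := le_of_not_forbidden hk hw (j := t - 1) fun h => by
    have := (hprev _ (by omega) (by omega) h).1
    omega
  obtain ⟨m, rfl⟩ : ∃ m, t = m + k := ⟨t - k, by omega⟩
  by_cases hV : AtV k w (m + 1)
  · refine ⟨m + 1, by omega, hV, ?_, ?_⟩
    · convert ha using 1; omega
    · convert hVs using 1; omega
  exfalso
  have hF2 : ∀ j, m < j → j < m + k → Forbidden (Sk k) w j → j = m + 1 := fun j h1 h2 h => by
    have := (hprev j (by omega) h2 h).1
    omega
  by_cases hm1 : Forbidden (Sk k) w (m + 1)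
  swap
  · exact no_subset_singleton hk hw (t := m) (by omega) fun i h1 h2 h =>
      hm1 (hF2 i h1 h2 h ▸ h)
  have hU : AtU k w (m + 1) := (hprev _ (by omega) (by omega) hm1).2.resolve_right hV
  have hm : ¬ Forbidden (Sk k) w m := by
    intro h
    rcases ((forbidden_iff hk).1 h).2 with h | h | h
    · have := hF2 _ (by omega) (by omega) h
      omega
    · have := h (m + 1) (by omega) (by omega)
      rw [hU.1] at this
      exact absurd (Option.some_injective _ this).symm a_ne_b
    · have := h (m + 2) (by omega) (by omega)
      rw [hU.2 _ (by omega) (by omega)] at this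
      exact absurd (Option.some_injective _ this) a_ne_b
  have hkm := le_of_not_forbidden hk hw hm
  obtain ⟨r, hr⟩ : ∃ r, m + 1 = r + k := ⟨m + 1 - k, by omega⟩
  have hF3 : ∀ j, r < j → j < r + k → Forbidden (Sk k) w j → j = r + 2 ∧ AtV k w j := by
    intro j h1 h2 h
    rcases ((forbidden_iff hk).1 h).1 with h3 | h3 | h3
    · by_cases hjm : j = m
      · exact absurd (hjm ▸ h) hm
      · have := hF2 _ (by omega) (by omega) h3
        omega
    · have := h3.2 (m + 1) (by omega) (by omega)
      rw [hU.1] at this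
      exact absurd (Option.some_injective _ this).symm a_ne_b
    · refine ⟨?_, h3⟩
      by_contra hne
      rcases Nat.lt_or_ge j (r + 2) with h4 | h4
      · have := h3.1
        rw [show j + k - 1 = m + 1 by omega, hU.1] at this
        exact absurd (Option.some_injective _ this).symm a_ne_b
      · have := h3.2 (m + 2) (by omega) (by omega)
        rw [hU.2 _ (by omega) (by omega)] at this
        exact absurd (Option.some_injective _ this) a_ne_b
  by_cases hV2 : AtV k w (r + 2)
  · refine no_v_overlapping_u hk hw (r := r) (by omega) (hr ▸ hU) hV2 (fun i h1 h2 h => ?_)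
      fun i h1 h2 h => ?_
    · by_cases hir : i = r
      · exact Or.inl hir
      · exact Or.inr (hF3 i (by omega) h2 h).1
    · by_cases him : i = m
      · exact absurd (him ▸ h) hm
      · have := hF2 i (by omega) (by omega) h
        omega
  · refine no_subset_singleton hk hw (t := r) (by omega) fun i h1 h2 h => ?_
    obtain ⟨rfl, h3⟩ := hF3 i h1 h2 h
    exact hV2 h3

lemma exists_suffix (hk : 4 ≤ k) (hw : MinUncompletable (Sk k) w) :
    ∃ y : Word, y.length % k = 1 ∧ (v k ++ List.replicate (k - 2) a ++ y ++ v k) <:+ w := by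
  obtain ⟨m, hm, hV, ha, hV'⟩ := exists_v_before_final_v hk hw
  refine ⟨(w.drop (m + 2 * k - 2)).take 1, ?_, ?_⟩
  · rw [List.length_take, List.length_drop, min_eq_left (by omega), Nat.mod_eq_of_lt (by omega)]
  have h1 := (atV_iff hk).1 hV
  have h2 := (atV_iff hk).1 hV'
  have h3 : (w.drop (m + k)).take (k - 2) = List.replicate (k - 2) a := by
    rw [take_drop_eq_iff (by simp)]
    intro i hi
    rw [ha _ (by omega) (by omega)]
    simp [hi]
  have key : ∀ i j n, i + n = j → w.drop i = (w.drop i).take n ++ w.drop j := by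
    rintro i j n rfl
    rw [← List.drop_drop, List.take_append_drop]
  have e : v k ++ List.replicate (k - 2) a ++ (w.drop (m + 2 * k - 2)).take 1 ++ v k =
      w.drop m := by
    have h4 := key (m + 2 * k - 2) (m + 2 * k - 1) 1 (by omega)
    generalize (w.drop (m + 2 * k - 2)).take 1 = c at h4 ⊢
    rw [key m (m + k) k rfl, h1, key (m + k) (m + 2 * k - 2) (k - 2) (by omega), h3, h4, ← h2,
      List.take_of_length_le (i := k) (by simp; omega)]
    simp
  rw [e]
  exact List.drop_suffix m w

end Minimal

/-- Reversal of a word combined with the exchange of the two letters. -/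
def dual (w : Word) : Word := (w.map not).reverse

@[simp] lemma dual_dual (w : Word) : dual (dual w) = w := by
  simp [dual, Function.comp_def]

@[simp] lemma length_dual (w : Word) : (dual w).length = w.length := by simp [dual]

@[simp] lemma dual_append (x y : Word) : dual (x ++ y) = dual y ++ dual x := by simp [dual]

lemma dual_eq_iff {x y : Word} : dual x = y ↔ x = dual y :=
  ⟨fun h => by rw [← h, dual_dual], fun h => by rw [h, dual_dual]⟩

@[simp] lemma dual_replicate_a (n : ℕ) : dual (List.replicate n a) = List.replicate n b := by
  simp [dual, a, b]

@[simp] lemma dual_replicate_b (n : ℕ) : dual (List.replicate n b) = List.replicate n a := by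
  simp [dual, a, b]

@[simp] lemma dual_v (k : ℕ) : dual (v k) = u k := by
  rw [v, dual_append, dual_replicate_b]
  rfl

@[simp] lemma dual_u (k : ℕ) : dual (u k) = v k := by
  rw [← dual_v, dual_dual]

lemma dual_mem_Sk {k : ℕ} {x : Word} (hx : x ∈ Sk k) : dual x ∈ Sk k := by
  rcases hx with ⟨h1, h2, h3⟩ | ⟨h1, h2, h3⟩
  · left
    refine ⟨by simpa, ?_, ?_⟩ <;> rw [Ne, dual_eq_iff] <;> simpa
  · right
    refine ⟨by simpa, ?_, ?_⟩ <;> rw [Ne, dual_eq_iff] <;> simpa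

lemma dual_flatten (L : List Word) : dual L.flatten = (L.map dual).reverse.flatten := by
  induction L with
  | nil => rfl
  | cons x L ih => simp [ih]

lemma dual_mem_kstar {k : ℕ} {x : Word} (hx : x ∈ kstar (Sk k)) : dual x ∈ kstar (Sk k) := by
  obtain ⟨L, hL, rfl⟩ := hx
  refine ⟨(L.map dual).reverse, fun y hy => ?_, (dual_flatten L).symm⟩
  obtain ⟨z, hz, rfl⟩ := List.mem_map.1 (List.mem_reverse.1 hy)
  exact dual_mem_Sk (hL z hz)

lemma dual_mem_Facts {k : ℕ} {w : Word} (hw : w ∈ Facts (kstar (Sk k))) :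
    dual w ∈ Facts (kstar (Sk k)) := by
  obtain ⟨x, y, h⟩ := hw
  exact ⟨dual y, dual x, by simpa using dual_mem_kstar h⟩

lemma MinUncompletable.dual {k : ℕ} {w : Word} (hw : MinUncompletable (Sk k) w) :
    MinUncompletable (Sk k) (dual w) := by
  refine ⟨fun h => hw.1 (by simpa using dual_mem_Facts h), fun w' h => ?_⟩
  simpa using hw.2 w' h

theorem statement19 (k : ℕ) (hk : 4 ≤ k) (w : Word)
    (hw : MinUncompletable (Sk k) w) :
    (∃ y : Word, y.length % k = 1 ∧
       (u k ++ y ++ List.replicate (k - 2) b ++ u k) <+: w) ∧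
    (∃ yh : Word, yh.length % k = 1 ∧
       (v k ++ List.replicate (k - 2) a ++ yh ++ v k) <:+ w) := by
  refine ⟨?_, exists_suffix hk hw⟩
  obtain ⟨y, hy, x, hx⟩ := exists_suffix hk hw.dual
  refine ⟨dual y, by simpa using hy, dual x, ?_⟩
  have := congrArg dual hx
  simpa using this

end Restivo
end
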